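/- arXiv:1912.10214 — 2 statements merged into one kernel-verified Lean document; each statement's English description precedes it below -/
import Mathlib

section
/- Let (𝒜, α) be a weighted system and let ρ(𝒜) denote the classical joint spectral radius of 𝒜 (all weights equal to 1). If ρ(𝒜) > 1, then ρ(𝒜)^{1/α_max} ≤ ρ(𝒜, α) ≤ ρ(𝒜)^{1/α_min}, where α_min and α_max denote the minimal and maximal weights. -/
open Filter

attribute [local instance] Matrix.linftyOpNormedRing

/-- The product `A(k)⋯A(1)` associated with the word `w = (i_1, …, i_k)`. -/
noncomputable def wordProd {d m : ℕ} (A : Fin m → Matrix (Fin d) (Fin d) ℝ)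
    (w : List (Fin m)) : Matrix (Fin d) (Fin d) ℝ :=
  ((w.map A).reverse).prod

/-- The total weight `α(k)+⋯+α(1)` of the word `w = (i_1, …, i_k)`. -/
def wordWeight {m : ℕ} (α : Fin m → ℝ) (w : List (Fin m)) : ℝ :=
  (w.map α).sum

/-- `ρ_k`: the maximum of `‖A(k)⋯A(1)‖^(1/(α(k)+⋯+α(1)))` over products of length `k`. -/
noncomputable def rhoSeq {d m : ℕ} (A : Fin m → Matrix (Fin d) (Fin d) ℝ)
    (α : Fin m → ℝ) (k : ℕ) : ℝ :=
  sSup {r : ℝ | ∃ w : List (Fin m), w.length = k ∧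
    r = ‖wordProd A w‖ ^ (1 / wordWeight α w)}

/-- The `α`-weighted joint spectral radius `ρ(𝒜, α) = limsup_{k→∞} ρ_k`. -/
noncomputable def wjsr {d m : ℕ} (A : Fin m → Matrix (Fin d) (Fin d) ℝ)
    (α : Fin m → ℝ) : ℝ :=
  limsup (rhoSeq A α) atTop

theorem norm_wordProd_le {d m : ℕ} (A : Fin m → Matrix (Fin d) (Fin d) ℝ) {C : ℝ}
    (hC : ∀ i, ‖A i‖ ≤ C) (hC0 : 0 ≤ C) (w : List (Fin m)) :
    ‖wordProd A w‖ ≤ C ^ w.length := by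
  induction w with
  | nil =>
    rcases isEmpty_or_nonempty (Fin d) with hd | hd
    · simp [Subsingleton.elim (wordProd A []) 0]
    · have := Matrix.linfty_opNormOneClass (α := ℝ) (n := Fin d)
      simp [wordProd]
  | cons i w ih =>
    have hcons : wordProd A (i :: w) = wordProd A w * A i := by simp [wordProd]
    rw [hcons, List.length_cons, pow_succ]
    exact (norm_mul_le _ _).trans (mul_le_mul ih (hC i) (norm_nonneg _) (by positivity))

theorem mul_length_le_wordWeight {m : ℕ} {α : Fin m → ℝ} {a : ℝ} (ha : ∀ i, a ≤ α i)
    (w : List (Fin m)) : w.length * a ≤ wordWeight α w := by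
  induction w with
  | nil => simp [wordWeight]
  | cons i w ih =>
    simp only [wordWeight, List.map_cons, List.sum_cons, List.length_cons] at ih ⊢
    push_cast
    linarith [ha i]

theorem wordWeight_le_mul_length {m : ℕ} {α : Fin m → ℝ} {b : ℝ} (hb : ∀ i, α i ≤ b)
    (w : List (Fin m)) : wordWeight α w ≤ w.length * b := by
  induction w with
  | nil => simp [wordWeight]
  | cons i w ih =>
    simp only [wordWeight, List.map_cons, List.sum_cons, List.length_cons] at ih ⊢
    push_cast
    linarith [hb i]

theorem wordWeight_one {m : ℕ} (w : List (Fin m)) :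
    wordWeight (fun _ => 1) w = w.length := by
  simp [wordWeight]

/-- The normalized norms of all words are uniformly bounded. -/
theorem exists_norm_rpow_le {d m : ℕ} (A : Fin m → Matrix (Fin d) (Fin d) ℝ)
    {α : Fin m → ℝ} {a : ℝ} (ha0 : 0 < a) (ha : ∀ i, a ≤ α i) :
    ∃ K : ℝ, 0 ≤ K ∧ ∀ w, ‖wordProd A w‖ ^ (1 / wordWeight α w) ≤ K := by
  obtain ⟨M, hM⟩ := (Set.finite_range fun i => ‖A i‖).bddAbove
  have hC1 : 1 ≤ max 1 M := le_max_left _ _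
  generalize hCdef : max 1 M = C at hC1
  have hC : ∀ i, ‖A i‖ ≤ C := fun i => by
    rw [← hCdef]; exact (hM ⟨i, rfl⟩).trans (le_max_right _ _)
  have hC0 : 0 ≤ C := by linarith
  refine ⟨C ^ (1 / a), by positivity, fun w => ?_⟩
  have hW := mul_length_le_wordWeight ha w
  have hW0 : 0 ≤ wordWeight α w := le_trans (by positivity) hW
  calc ‖wordProd A w‖ ^ (1 / wordWeight α w)
      ≤ (C ^ w.length) ^ (1 / wordWeight α w) :=
        Real.rpow_le_rpow (norm_nonneg _) (norm_wordProd_le A hC hC0 w) (by positivity)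
    _ = C ^ (w.length * (1 / wordWeight α w)) := by
        rw [Real.rpow_mul hC0, Real.rpow_natCast]
    _ ≤ C ^ (1 / a) := by
        apply Real.rpow_le_rpow_of_exponent_le hC1
        rw [mul_one_div, le_div_iff₀ ha0, div_mul_eq_mul_div]
        exact div_le_one_of_le₀ hW hW0

theorem le_rhoSeq {d m : ℕ} (A : Fin m → Matrix (Fin d) (Fin d) ℝ)
    {α : Fin m → ℝ} {a : ℝ} (ha0 : 0 < a) (ha : ∀ i, a ≤ α i) (w : List (Fin m)) :
    ‖wordProd A w‖ ^ (1 / wordWeight α w) ≤ rhoSeq A α w.length := by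
  obtain ⟨K, -, hK⟩ := exists_norm_rpow_le A ha0 ha
  refine le_csSup ⟨K, ?_⟩ ⟨w, rfl, rfl⟩
  rintro _ ⟨v, -, rfl⟩
  exact hK v

theorem rhoSeq_nonneg {d m : ℕ} (A : Fin m → Matrix (Fin d) (Fin d) ℝ)
    (α : Fin m → ℝ) (k : ℕ) : 0 ≤ rhoSeq A α k := by
  apply Real.sSup_nonneg
  rintro _ ⟨w, -, rfl⟩
  positivity

theorem isBoundedUnder_le_rhoSeq {d m : ℕ} (A : Fin m → Matrix (Fin d) (Fin d) ℝ)
    {α : Fin m → ℝ} {a : ℝ} (ha0 : 0 < a) (ha : ∀ i, a ≤ α i) :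
    IsBoundedUnder (· ≤ ·) atTop (rhoSeq A α) := by
  obtain ⟨K, hK0, hK⟩ := exists_norm_rpow_le A ha0 ha
  refine isBoundedUnder_of ⟨K, fun k => Real.sSup_le ?_ hK0⟩
  rintro _ ⟨w, -, rfl⟩
  exact hK w

theorem isBoundedUnder_ge_rhoSeq {d m : ℕ} (A : Fin m → Matrix (Fin d) (Fin d) ℝ)
    (α : Fin m → ℝ) : IsBoundedUnder (· ≥ ·) atTop (rhoSeq A α) :=
  isBoundedUnder_of ⟨0, rhoSeq_nonneg A α⟩

theorem rhoSeq_le_rpow {d m : ℕ} (A : Fin m → Matrix (Fin d) (Fin d) ℝ)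
    {α : Fin m → ℝ} {a : ℝ} (ha0 : 0 < a) (ha : ∀ i, a ≤ α i) {k : ℕ} (hk : 0 < k)
    {t : ℝ} (ht1 : 1 ≤ t) (ht : rhoSeq A (fun _ => 1) k ≤ t) :
    rhoSeq A α k ≤ t ^ (1 / a) := by
  refine Real.sSup_le ?_ (by positivity)
  rintro _ ⟨w, rfl, rfl⟩
  have hw : (0 : ℝ) < w.length := by exact_mod_cast hk
  have hW := mul_length_le_wordWeight ha w
  have hW0 : 0 < wordWeight α w := lt_of_lt_of_le (by positivity) hW
  rcases le_total ‖wordProd A w‖ 1 with hx | hx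
  · exact (Real.rpow_le_one (norm_nonneg _) hx (by positivity)).trans
      (Real.one_le_rpow ht1 (by positivity))
  · have hr := (le_rhoSeq A one_pos (fun _ => le_rfl) w).trans ht
    rw [wordWeight_one] at hr
    calc ‖wordProd A w‖ ^ (1 / wordWeight α w)
        ≤ ‖wordProd A w‖ ^ (1 / (w.length * a)) :=
          Real.rpow_le_rpow_of_exponent_le hx (one_div_le_one_div_of_le (by positivity) hW)
      _ = (‖wordProd A w‖ ^ (1 / (w.length : ℝ))) ^ (1 / a) := by
          rw [← Real.rpow_mul (norm_nonneg _), one_div_mul_one_div]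
      _ ≤ t ^ (1 / a) := Real.rpow_le_rpow (by positivity) hr (by positivity)

theorem rpow_le_rhoSeq {d m : ℕ} (A : Fin m → Matrix (Fin d) (Fin d) ℝ)
    {α : Fin m → ℝ} {a b : ℝ} (ha0 : 0 < a) (ha : ∀ i, a ≤ α i) (hb0 : 0 < b)
    (hb : ∀ i, α i ≤ b) {k : ℕ} (hk : 0 < k)
    {t : ℝ} (ht1 : 1 ≤ t) (ht : t < rhoSeq A (fun _ => 1) k) :
    t ^ (1 / b) ≤ rhoSeq A α k := by
  obtain ⟨w, rfl, hw⟩ : ∃ w : List (Fin m), w.length = k ∧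
      t < ‖wordProd A w‖ ^ (1 / wordWeight (fun _ => 1) w) := by
    by_contra! hcon
    refine ht.not_ge (Real.sSup_le ?_ (by linarith))
    rintro _ ⟨w, hw, rfl⟩
    exact hcon w hw
  rw [wordWeight_one] at hw
  have hl : (0 : ℝ) < w.length := by exact_mod_cast hk
  have hW0 : 0 < wordWeight α w :=
    lt_of_lt_of_le (by positivity) (mul_length_le_wordWeight ha w)
  have hx : 1 ≤ ‖wordProd A w‖ := by
    by_contra! hx
    have := Real.rpow_le_one (norm_nonneg _) hx.le (one_div_pos.2 hl).le
    linarith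
  calc t ^ (1 / b) ≤ (‖wordProd A w‖ ^ (1 / (w.length : ℝ))) ^ (1 / b) :=
        Real.rpow_le_rpow (by linarith) hw.le (by positivity)
    _ = ‖wordProd A w‖ ^ (1 / (w.length * b)) := by
        rw [← Real.rpow_mul (norm_nonneg _), one_div_mul_one_div]
    _ ≤ ‖wordProd A w‖ ^ (1 / wordWeight α w) :=
        Real.rpow_le_rpow_of_exponent_le hx
          (one_div_le_one_div_of_le hW0 (wordWeight_le_mul_length hb w))
    _ ≤ rhoSeq A α w.length := le_rhoSeq A ha0 ha w

/-- If the classical joint spectral radius `ρ(𝒜)` is `> 1`, then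
`ρ(𝒜)^{1/α_max} ≤ ρ(𝒜, α) ≤ ρ(𝒜)^{1/α_min}`. -/
theorem wjsr_bounds_of_one_lt_jsr {d m : ℕ} (hm : 0 < m)
    (A : Fin m → Matrix (Fin d) (Fin d) ℝ)
    (α : Fin m → ℝ) (hα : ∀ i, 0 < α i)
    (h : 1 < wjsr A (fun _ => 1)) :
    wjsr A (fun _ => 1) ^ (1 / ⨆ i, α i) ≤ wjsr A α ∧
      wjsr A α ≤ wjsr A (fun _ => 1) ^ (1 / ⨅ i, α i) := by
  have : Nonempty (Fin m) := ⟨⟨0, hm⟩⟩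
  have ha : ∀ i, ⨅ j, α j ≤ α i := ciInf_le (Set.finite_range α).bddBelow
  have hb : ∀ i, α i ≤ ⨆ j, α j := le_ciSup (Set.finite_range α).bddAbove
  have ha0 : 0 < ⨅ j, α j := by
    obtain ⟨i, hi⟩ := exists_eq_ciInf_of_finite (f := α)
    exact hi ▸ hα i
  have hb0 : 0 < ⨆ j, α j := (hα ⟨0, hm⟩).trans_le (hb _)
  have hcont : ∀ p : ℝ, ContinuousAt (fun t : ℝ => t ^ p) (wjsr A fun _ => 1) := fun p =>
    Real.continuousAt_rpow_const _ _ (Or.inl (by linarith))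
  constructor
  · refine le_of_tendsto (x := nhdsWithin (wjsr A fun _ => 1) (Set.Iio (wjsr A fun _ => 1)))
      ((hcont _).tendsto.mono_left nhdsWithin_le_nhds) ?_
    filter_upwards [Ioo_mem_nhdsLT h] with t ht
    refine le_limsup_of_frequently_le ?_ (isBoundedUnder_le_rhoSeq A ha0 ha)
    have hfreq : ∃ᶠ k in atTop, t < rhoSeq A (fun _ => 1) k :=
      frequently_lt_of_lt_limsup (isBoundedUnder_ge_rhoSeq A _).isCoboundedUnder_le ht.2
    refine (hfreq.and_eventually (eventually_gt_atTop 0)).mono fun k hk => ?_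
    exact rpow_le_rhoSeq A ha0 ha hb0 hb hk.2 ht.1.le hk.1
  · refine ge_of_tendsto (x := nhdsWithin (wjsr A fun _ => 1) (Set.Ioi (wjsr A fun _ => 1)))
      ((hcont _).tendsto.mono_left nhdsWithin_le_nhds) ?_
    filter_upwards [self_mem_nhdsWithin] with t ht
    refine limsup_le_of_le (isBoundedUnder_ge_rhoSeq A α).isCoboundedUnder_le ?_
    have hev : ∀ᶠ k in atTop, rhoSeq A (fun _ => 1) k < t :=
      eventually_lt_of_limsup_lt ht (isBoundedUnder_le_rhoSeq A one_pos fun _ => le_rfl)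
    filter_upwards [hev, eventually_gt_atTop 0] with k hk hk0
    exact rhoSeq_le_rpow A ha0 ha hk0 (h.trans ht).le hk.le
end

section
/- If the finite family of real d×d matrices 𝒜 = {A_1, …, A_m} is irreducible (there is no linear subspace V of ℝ^d with 0 ≠ V ≠ ℝ^d such that A_j V ⊆ V for every j), then for every family of strictly positive weights α the weighted system (𝒜, α) is non-defective: there exists C > 0 such that for every k ≥ 1 and every product A(k)⋯A(1) with A(j) ∈ 𝒜 one has ‖A(k)⋯A(1)‖ ≤ C·ρ(𝒜,α)^{α(k)+⋯+α(1)}. -/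
open Filter

attribute [local instance] Matrix.linftyOpNormedRing

/-- If `P * f i * Q` cannot vanish for all `i` unless `P = 0` or `Q = 0`, then finitely many `i`
suffice to bound `‖P * f i * Q‖` below by a fixed multiple of `‖P‖ * ‖Q‖`. -/
theorem exists_finset_le_norm_mul_mul {R ι : Type*} [NormedRing R] [NormedAlgebra ℝ R]
    [FiniteDimensional ℝ R] [Nonempty ι] (f : ι → R)
    (h : ∀ P Q : R, P ≠ 0 → Q ≠ 0 → ∃ i, P * f i * Q ≠ 0) :
    ∃ (t : Finset ι) (δ : ℝ), 0 < δ ∧ δ ≤ 1 ∧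
      ∀ P Q : R, ∃ i ∈ t, δ * ‖P‖ * ‖Q‖ ≤ ‖P * f i * Q‖ := by
  classical
  have : ProperSpace R := FiniteDimensional.proper_real R
  let g : ι → R × R → ℝ := fun i p => ‖p.1 * f i * p.2‖
  have hg : ∀ i, Continuous (g i) := fun i => by fun_prop
  let S : Set (R × R) := Metric.sphere 0 1 ×ˢ Metric.sphere 0 1
  have hS : IsCompact S := (isCompact_sphere _ _).prod (isCompact_sphere _ _)
  -- Cover by the sets where one product is bigger than a fixed positive number.
  obtain ⟨T, hT⟩ := hS.elim_finite_subcover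
    (fun j : ι × ℕ => {p | 1 / ((j.2 : ℝ) + 1) < g j.1 p})
    (fun j => isOpen_lt continuous_const (hg j.1)) (by
      rintro ⟨P, Q⟩ ⟨hP, hQ⟩
      have hP' : P ≠ 0 := ne_zero_of_mem_unit_sphere ⟨P, hP⟩
      have hQ' : Q ≠ 0 := ne_zero_of_mem_unit_sphere ⟨Q, hQ⟩
      obtain ⟨i, hi⟩ := h P Q hP' hQ'
      obtain ⟨n, hn⟩ := exists_nat_one_div_lt (norm_pos_iff.mpr hi)
      exact Set.mem_iUnion.mpr ⟨(i, n), hn⟩)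
  obtain ⟨i₀⟩ := ‹Nonempty ι›
  let N : ℕ := T.sup Prod.snd
  have hN : (0 : ℝ) < (N : ℝ) + 1 := by positivity
  refine ⟨insert i₀ (T.image Prod.fst), 1 / ((N : ℝ) + 1), by positivity, ?_, ?_⟩
  · rw [div_le_one hN]
    simp
  · intro P Q
    by_cases hP : P = 0
    · exact ⟨i₀, Finset.mem_insert_self _ _, by simp [hP]⟩
    by_cases hQ : Q = 0
    · exact ⟨i₀, Finset.mem_insert_self _ _, by simp [hQ]⟩
    have hP' := norm_pos_iff.mpr hP
    have hQ' := norm_pos_iff.mpr hQ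
    have hmem : (‖P‖⁻¹ • P, ‖Q‖⁻¹ • Q) ∈ S := by
      simp [S, norm_smul, hP'.ne', hQ'.ne']
    obtain ⟨⟨i, n⟩, hj, hlt⟩ : ∃ j ∈ T, 1 / ((j.2 : ℝ) + 1) <
        g j.1 (‖P‖⁻¹ • P, ‖Q‖⁻¹ • Q) := by
      simpa using hT hmem
    have hnN : (n : ℝ) ≤ N := by exact_mod_cast Finset.le_sup (f := Prod.snd) hj
    have hle : 1 / ((N : ℝ) + 1) ≤ ‖Q‖⁻¹ * (‖P‖⁻¹ * ‖P * f i * Q‖) := by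
      refine (one_div_le_one_div_of_le (by positivity) (by linarith)).trans (hlt.le.trans ?_)
      simp [g, norm_smul]
    refine ⟨i, Finset.mem_insert_of_mem (Finset.mem_image_of_mem _ hj), ?_⟩
    calc 1 / ((N : ℝ) + 1) * ‖P‖ * ‖Q‖
        ≤ ‖Q‖⁻¹ * (‖P‖⁻¹ * ‖P * f i * Q‖) * ‖P‖ * ‖Q‖ := by gcongr
      _ = ‖P * f i * Q‖ := by field_simp

section WeightedSystem

variable {d m : ℕ} (A : Fin m → Matrix (Fin d) (Fin d) ℝ) (α : Fin m → ℝ)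

theorem wordProd_append (v w : List (Fin m)) :
    wordProd A (v ++ w) = wordProd A w * wordProd A v := by
  simp [wordProd]

theorem wordWeight_append (v w : List (Fin m)) :
    wordWeight α (v ++ w) = wordWeight α v + wordWeight α w := by
  simp [wordWeight]

variable {α} in
theorem wordWeight_nonneg (hα : ∀ i, 0 < α i) (w : List (Fin m)) : 0 ≤ wordWeight α w :=
  List.sum_nonneg fun x hx => by
    obtain ⟨i, -, rfl⟩ := List.mem_map.mp hx
    exact (hα i).le

variable {α} in
theorem wordWeight_pos (hα : ∀ i, 0 < α i) {w : List (Fin m)} (hw : w ≠ []) :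
    0 < wordWeight α w := by
  cases w with
  | nil => exact absurd rfl hw
  | cons i w =>
    have h := wordWeight_nonneg hα w
    have hi := hα i
    simp only [wordWeight, List.map_cons, List.sum_cons] at h ⊢
    linarith

variable {α} in
theorem length_mul_le_wordWeight {a : ℝ} (ha : ∀ i, a ≤ α i) (w : List (Fin m)) :
    w.length * a ≤ wordWeight α w := by
  induction w with
  | nil => simp [wordWeight]
  | cons i w ih =>
    have hi := ha i
    simp only [wordWeight, List.map_cons, List.sum_cons, List.length_cons] at ih ⊢
    push_cast
    linarith

variable {A} in
theorem norm_wordProd_le_pow {B : ℝ} (hB : ∀ i, ‖A i‖ ≤ B) (w : List (Fin m)) :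
    ‖wordProd A w‖ ≤ B ^ w.length := by
  induction w with
  | nil =>
    rcases Nat.eq_zero_or_pos d with rfl | hd
    · simp [wordProd, Subsingleton.elim (1 : Matrix (Fin 0) (Fin 0) ℝ) 0]
    · have : Nonempty (Fin d) := ⟨⟨0, hd⟩⟩
      simp [wordProd]
  | cons i w ih =>
    have h : wordProd A (i :: w) = wordProd A w * A i := by simp [wordProd]
    rw [h, List.length_cons, pow_succ]
    exact (norm_mul_le _ _).trans
      (mul_le_mul ih (hB i) (norm_nonneg _) ((norm_nonneg _).trans ih))

variable {α} in
theorem exists_norm_wordProd_rpow_le (hα : ∀ i, 0 < α i) :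
    ∃ M : ℝ, ∀ w : List (Fin m), ‖wordProd A w‖ ^ (1 / wordWeight α w) ≤ M := by
  obtain ⟨B₀, hB₀⟩ := (Set.finite_range fun i => ‖A i‖).bddAbove
  obtain ⟨a, ha0, ha⟩ : ∃ a : ℝ, 0 < a ∧ ∀ i, a ≤ α i := by
    rcases isEmpty_or_nonempty (Fin m) with h | h
    · exact ⟨1, one_pos, fun i => h.elim i⟩
    · obtain ⟨i, hi⟩ := Finite.exists_min α
      exact ⟨α i, hα i, hi⟩
  let B := max B₀ 1
  have hB1 : 1 ≤ B := le_max_right _ _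
  have hB : ∀ i, ‖A i‖ ≤ B := fun i => (hB₀ ⟨i, rfl⟩).trans (le_max_left _ _)
  refine ⟨B ^ (1 / a), fun w => ?_⟩
  rcases eq_or_ne w [] with rfl | hw
  · simpa [wordWeight] using Real.one_le_rpow hB1 (inv_nonneg.mpr ha0.le)
  have hW := wordWeight_pos hα hw
  calc ‖wordProd A w‖ ^ (1 / wordWeight α w)
      ≤ (B ^ w.length) ^ (1 / wordWeight α w) :=
        Real.rpow_le_rpow (norm_nonneg _) (norm_wordProd_le_pow hB w) (by positivity)
    _ = B ^ (w.length * (1 / wordWeight α w)) := by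
        rw [← Real.rpow_natCast, ← Real.rpow_mul (by positivity)]
    _ ≤ B ^ (1 / a) := by
        refine Real.rpow_le_rpow_of_exponent_le hB1 ?_
        rw [mul_one_div, div_le_div_iff₀ hW ha0, one_mul]
        exact length_mul_le_wordWeight ha w

variable {A α} in
/-- A lower bound for `‖A(k)⋯A(1)‖ ^ (1 / (α(k)+⋯+α(1)))` along arbitrarily long words is a lower
bound for the weighted joint spectral radius. -/
theorem le_wjsr (hα : ∀ i, 0 < α i) {L : ℝ}
    (hL : ∀ n : ℕ, ∃ w : List (Fin m), n ≤ w.length ∧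
      L ≤ ‖wordProd A w‖ ^ (1 / wordWeight α w)) : L ≤ wjsr A α := by
  obtain ⟨M, hM⟩ := exists_norm_wordProd_rpow_le A hα
  have hM0 : 0 ≤ M := (Real.rpow_nonneg (norm_nonneg _) _).trans (hM [])
  refine le_limsup_of_frequently_le (frequently_atTop.mpr fun n => ?_)
    (isBoundedUnder_of ⟨M, fun k => Real.sSup_le ?_ hM0⟩)
  · obtain ⟨w, hn, hw⟩ := hL n
    refine ⟨w.length, hn, hw.trans (le_csSup ⟨M, ?_⟩ ⟨w, rfl, rfl⟩)⟩
    rintro _ ⟨v, -, rfl⟩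
    exact hM v
  · rintro _ ⟨v, -, rfl⟩
    exact hM v

variable {A} in
theorem exists_mul_wordProd_mul_ne_zero
    (hirr : ∀ V : Submodule ℝ (Fin d → ℝ),
      (∀ j : Fin m, ∀ x ∈ V, (A j).mulVec x ∈ V) → V = ⊥ ∨ V = ⊤)
    (P Q : Matrix (Fin d) (Fin d) ℝ) (hP : P ≠ 0) (hQ : Q ≠ 0) :
    ∃ w : List (Fin m), P * wordProd A w * Q ≠ 0 := by
  by_contra! h
  obtain ⟨x, hx⟩ : ∃ x, Q.mulVec x ≠ 0 := by
    by_contra! hx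
    exact hQ (Matrix.ext_of_mulVec_single fun i => by simp only [hx, Matrix.zero_mulVec])
  let V : Submodule ℝ (Fin d → ℝ) :=
    Submodule.span ℝ (Set.range fun w => (wordProd A w).mulVec (Q.mulVec x))
  have hV : ∀ j : Fin m, ∀ y ∈ V, (A j).mulVec y ∈ V := by
    intro j y hy
    have hle : V ≤ V.comap (A j).mulVecLin := by
      refine Submodule.span_le.mpr ?_
      rintro _ ⟨w, rfl⟩
      refine Submodule.subset_span ⟨w ++ [j], ?_⟩
      simp only [wordProd_append, Matrix.mulVecLin_apply, Matrix.mulVec_mulVec]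
      simp [wordProd, mul_assoc]
    exact hle hy
  have hxV : Q.mulVec x ∈ V := Submodule.subset_span ⟨[], by simp [wordProd]⟩
  have hker : V ≤ LinearMap.ker P.mulVecLin := by
    refine Submodule.span_le.mpr ?_
    rintro _ ⟨w, rfl⟩
    simp only [SetLike.mem_coe, LinearMap.mem_ker, Matrix.mulVecLin_apply, Matrix.mulVec_mulVec,
      ← mul_assoc, h w, Matrix.zero_mulVec]
  rcases hirr V hV with hbot | htop
  · rw [hbot] at hxV
    exact hx ((Submodule.mem_bot ℝ).mp hxV)
  · refine hP (Matrix.ext_of_mulVec_single fun i => ?_)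
    have hi : Pi.single i 1 ∈ V := htop ▸ Submodule.mem_top
    rw [Matrix.zero_mulVec]
    exact LinearMap.mem_ker.mp (hker hi)

variable {A} in
/-- For an irreducible family, any two matrices `P`, `Q` can be joined by a product of bounded
weight without losing more than a constant factor in `‖P‖ * ‖Q‖`. -/
theorem exists_joining_word
    (hirr : ∀ V : Submodule ℝ (Fin d → ℝ),
      (∀ j : Fin m, ∀ x ∈ V, (A j).mulVec x ∈ V) → V = ⊥ ∨ V = ⊤) :
    ∃ δ K : ℝ, 0 < δ ∧ δ ≤ 1 ∧ 0 ≤ K ∧ ∀ P Q : Matrix (Fin d) (Fin d) ℝ,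
      ∃ w : List (Fin m), wordWeight α w ≤ K ∧
        δ * ‖P‖ * ‖Q‖ ≤ ‖P * wordProd A w * Q‖ := by
  let _ : NormedAlgebra ℝ (Matrix (Fin d) (Fin d) ℝ) := Matrix.linftyOpNormedAlgebra
  obtain ⟨t, δ, hδ, hδ1, ht⟩ :=
    exists_finset_le_norm_mul_mul (wordProd A) (exists_mul_wordProd_mul_ne_zero hirr)
  refine ⟨δ, ∑ w ∈ t, |wordWeight α w|, hδ, hδ1, by positivity, fun P Q => ?_⟩
  obtain ⟨w, hw, h⟩ := ht P Q
  exact ⟨w, (le_abs_self _).trans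
    (Finset.single_le_sum (f := fun w => |wordWeight α w|) (fun _ _ => abs_nonneg _) hw), h⟩

variable {A α} in
/-- Repeating a word `u`, with suitable joining words in between. -/
theorem exists_repeated_word (hα : ∀ i, 0 < α i) {δ K : ℝ} (hδ : 0 ≤ δ) (hδ1 : δ ≤ 1)
    (hK : 0 ≤ K)
    (hjoin : ∀ P Q : Matrix (Fin d) (Fin d) ℝ, ∃ w : List (Fin m), wordWeight α w ≤ K ∧
      δ * ‖P‖ * ‖Q‖ ≤ ‖P * wordProd A w * Q‖)
    {u : List (Fin m)} (hu : u ≠ []) (n : ℕ) :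
    ∃ v : List (Fin m), n + 1 ≤ v.length ∧
      ((n + 1 : ℕ) : ℝ) * wordWeight α u ≤ wordWeight α v ∧
      wordWeight α v ≤ ((n + 1 : ℕ) : ℝ) * (wordWeight α u + K) ∧
      (δ * ‖wordProd A u‖) ^ (n + 1) ≤ ‖wordProd A v‖ := by
  have hlen : 1 ≤ u.length := List.length_pos_iff.mpr hu
  induction n with
  | zero =>
    refine ⟨u, by simpa using hlen, by simp, by simpa using hK, ?_⟩
    simpa using mul_le_of_le_one_left (norm_nonneg (wordProd A u)) hδ1
  | succ n ih =>
    obtain ⟨v, hv, hlo, hhi, hnorm⟩ := ih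
    obtain ⟨w, hwK, hw⟩ := hjoin (wordProd A v) (wordProd A u)
    have hw0 := wordWeight_nonneg hα w
    refine ⟨u ++ (w ++ v), ?_, ?_, ?_, ?_⟩
    · simp only [List.length_append]
      omega
    · simp only [wordWeight_append]
      push_cast at hlo ⊢
      linarith
    · simp only [wordWeight_append]
      push_cast at hhi ⊢
      linarith
    · rw [wordProd_append, wordProd_append, pow_succ]
      calc (δ * ‖wordProd A u‖) ^ (n + 1) * (δ * ‖wordProd A u‖)
          ≤ ‖wordProd A v‖ * (δ * ‖wordProd A u‖) := by gcongr
        _ = δ * ‖wordProd A v‖ * ‖wordProd A u‖ := by ring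
        _ ≤ _ := hw

end WeightedSystem

theorem min_rpow_le_rpow {x s p q : ℝ} (hx : 0 ≤ x) (hp : 0 ≤ p) (hps : p ≤ s) (hsq : s ≤ q) :
    min (x ^ q) (x ^ p) ≤ x ^ s := by
  rcases le_total x 1 with h | h
  · exact (min_le_left _ _).trans
      (Real.rpow_le_rpow_of_exponent_ge_of_imp hx h hsq fun _ h0 => by linarith)
  · exact (min_le_right _ _).trans (Real.rpow_le_rpow_of_exponent_le h hps)


/-- **Corollary 2.11.** If the family `𝒜` is irreducible (no nontrivial proper
subspace of `ℝ^d` is invariant under every `A_j`), then for every family of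
positive weights `α` the weighted system `(𝒜, α)` is non-defective. -/
theorem nondefective_of_irreducible {d m : ℕ} (hm : 0 < m)
    (A : Fin m → Matrix (Fin d) (Fin d) ℝ)
    (hirr : ∀ V : Submodule ℝ (Fin d → ℝ),
      (∀ j : Fin m, ∀ x ∈ V, (A j).mulVec x ∈ V) → V = ⊥ ∨ V = ⊤)
    (α : Fin m → ℝ) (hα : ∀ i, 0 < α i) :
    ∃ C : ℝ, 0 < C ∧ ∀ w : List (Fin m), w ≠ [] →
      ‖wordProd A w‖ ≤ C * wjsr A α ^ wordWeight α w := by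
  obtain ⟨δ, K, hδ, hδ1, hK, hjoin⟩ := exists_joining_word α hirr
  set ρ := wjsr A α with hρ
  refine ⟨max 1 (ρ ^ K) / δ, by positivity, fun u hu => ?_⟩
  have ha := wordWeight_pos hα hu
  set a := wordWeight α u
  set x := δ * ‖wordProd A u‖ with hx
  have hx0 : 0 ≤ x := by positivity
  have hle : min (x ^ (1 / a)) (x ^ (1 / (a + K))) ≤ ρ := by
    refine le_wjsr hα fun n => ?_
    obtain ⟨v, hv, hlo, hhi, hnorm⟩ := exists_repeated_word hα hδ.le hδ1 hK hjoin hu n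
    have hn : (0 : ℝ) < ((n + 1 : ℕ) : ℝ) := by positivity
    have hW : 0 < wordWeight α v := lt_of_lt_of_le (by positivity) hlo
    refine ⟨v, by omega, ?_⟩
    calc min (x ^ (1 / a)) (x ^ (1 / (a + K)))
        ≤ x ^ (((n + 1 : ℕ) : ℝ) * (1 / wordWeight α v)) := by
          refine min_rpow_le_rpow hx0 (by positivity) ?_ ?_
          · rw [mul_one_div, div_le_div_iff₀ (by positivity) hW, one_mul]
            exact hhi
          · rw [mul_one_div, div_le_div_iff₀ hW ha, one_mul]
            exact hlo
      _ = (x ^ (n + 1)) ^ (1 / wordWeight α v) := by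
          rw [Real.rpow_mul hx0, Real.rpow_natCast]
      _ ≤ ‖wordProd A v‖ ^ (1 / wordWeight α v) :=
          Real.rpow_le_rpow (by positivity) hnorm (by positivity)
  have hρ0 : 0 ≤ ρ := (le_min (by positivity) (by positivity)).trans hle
  have hroot : ∀ {b : ℝ}, 0 < b → x ^ (1 / b) ≤ ρ → x ≤ ρ ^ b := fun hb h => by
    rw [one_div] at h
    exact (Real.rpow_inv_le_iff_of_pos hx0 hρ0 hb).mp h
  have hxle : x ≤ max 1 (ρ ^ K) * ρ ^ a := by
    have hρa : 0 ≤ ρ ^ a := by positivity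
    rcases min_le_iff.mp hle with h | h
    · exact (hroot ha h).trans (le_mul_of_one_le_left hρa (le_max_left _ _))
    · refine (hroot (by positivity) h).trans ?_
      rw [Real.rpow_add_of_nonneg hρ0 ha.le hK, mul_comm]
      exact mul_le_mul_of_nonneg_right (le_max_right _ _) hρa
  rw [div_mul_eq_mul_div, le_div_iff₀ hδ, mul_comm]
  exact hxle
end
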